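/- If G is a 3-connected planar graph and {u,v,w} is a 3-cut in G, then u, v, w are not all contained in the boundary of a common face of any planar embedding of G. -/

import Mathlib

open SimpleGraph Set

/-- A plane embedding of a simple graph: vertices are mapped to points of the plane,
edges to injective arcs, such that arcs meet only in common endpoints. -/
structure PlaneEmbedding {V : Type*} (G : SimpleGraph V) where
  vertexMap : V → ℝ × ℝ
  vertex_inj : Function.Injective vertexMap
  edgeMap : ∀ ⦃a b : V⦄, G.Adj a b → C(unitInterval, ℝ × ℝ)
  edge_start : ∀ ⦃a b : V⦄ (h : G.Adj a b), edgeMap h 0 = vertexMap a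
  edge_end : ∀ ⦃a b : V⦄ (h : G.Adj a b), edgeMap h 1 = vertexMap b
  edge_inj : ∀ ⦃a b : V⦄ (h : G.Adj a b), Function.Injective (edgeMap h)
  edge_symm : ∀ ⦃a b : V⦄ (h : G.Adj a b),
    Set.range (edgeMap h) = Set.range (edgeMap h.symm)
  edge_int : ∀ ⦃a b c d : V⦄ (h : G.Adj a b) (h' : G.Adj c d),
    s(a, b) ≠ s(c, d) →
    Set.range (edgeMap h) ∩ Set.range (edgeMap h') ⊆
      vertexMap '' (({a, b} : Set V) ∩ {c, d})
  edge_no_vertex : ∀ ⦃a b : V⦄ (h : G.Adj a b) (x : V),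
    vertexMap x ∈ Set.range (edgeMap h) → x = a ∨ x = b

variable {V : Type*}

/-- The subset of the plane covered by the drawing of the graph. -/
def PlaneEmbedding.drawing {G : SimpleGraph V} (E : PlaneEmbedding G) : Set (ℝ × ℝ) :=
  Set.range E.vertexMap ∪ ⋃ (a : V) (b : V) (h : G.Adj a b), Set.range (E.edgeMap h)

/-- A face of a plane embedding: a connected component of the complement of the drawing. -/
def PlaneEmbedding.IsFace {G : SimpleGraph V} (E : PlaneEmbedding G)
    (F : Set (ℝ × ℝ)) : Prop :=
  ∃ x ∈ E.drawingᶜ, F = connectedComponentIn E.drawingᶜ x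

/-- A face whose boundary is the union of the arcs of three mutually adjacent vertices. -/
def PlaneEmbedding.FaceIsTriangleOn {G : SimpleGraph V} (E : PlaneEmbedding G)
    (F : Set (ℝ × ℝ)) (a b c : V) : Prop :=
  ∃ (h1 : G.Adj a b) (h2 : G.Adj b c) (h3 : G.Adj c a),
    frontier F = Set.range (E.edgeMap h1) ∪ Set.range (E.edgeMap h2) ∪
      Set.range (E.edgeMap h3)

/-- A face of a plane embedding is a triangle if it is bounded by three arcs of a 3-cycle. -/
def PlaneEmbedding.FaceIsTriangle {G : SimpleGraph V} (E : PlaneEmbedding G)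
    (F : Set (ℝ × ℝ)) : Prop :=
  ∃ a b c : V, E.FaceIsTriangleOn F a b c

/-- `(a,b,c)` is a facial triangle of the embedding `E`. -/
def PlaneEmbedding.IsFacialTriangle {G : SimpleGraph V} (E : PlaneEmbedding G)
    (a b c : V) : Prop :=
  ∃ F : Set (ℝ × ℝ), E.IsFace F ∧ E.FaceIsTriangleOn F a b c

/-- A graph is planar if it admits a plane embedding. -/
def IsPlanar (G : SimpleGraph V) : Prop := Nonempty (PlaneEmbedding G)

/-- A graph is `k`-connected if it has more than `k` vertices and removing fewer than
`k` vertices always leaves a connected graph. -/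
def IsKConnected (k : ℕ) (G : SimpleGraph V) : Prop :=
  k < Nat.card V ∧ ∀ S : Set V, S.Finite → S.ncard < k → (G.induce Sᶜ).Connected

/-- A 3-cut: a set of 3 vertices whose removal disconnects the graph. -/
def IsThreeCut (G : SimpleGraph V) (S : Set V) : Prop :=
  S.ncard = 3 ∧ ¬ (G.induce Sᶜ).Preconnected

/-- `C` is (the vertex set of) a connected component of `G - S`. -/
def IsCompOf (G : SimpleGraph V) (S : Set V) (C : Set V) : Prop :=
  C.Nonempty ∧ C ⊆ Sᶜ ∧ (G.induce C).Connected ∧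
    ∀ a ∈ C, ∀ b ∈ Sᶜ, G.Adj a b → b ∈ C

/-- The edge closed component of `G - {u,v,w}` corresponding to the component `C`:
the graph induced on `C ∪ {u,v,w}` with the edges `uv`, `vw`, `wu` added. -/
def edgeClosedGraph (G : SimpleGraph V) (u v w : V) (C : Set V) :
    SimpleGraph ↥(C ∪ {u, v, w}) :=
  SimpleGraph.fromRel (fun a b =>
    G.Adj a b ∨ ((a : V) ∈ ({u, v, w} : Set V) ∧ (b : V) ∈ ({u, v, w} : Set V)))

/-- A nowhere vanishing continuous function on a simply connected, locally path connected space
has a continuous logarithm. -/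
theorem exists_continuous_log {A : Type*} [TopologicalSpace A] [SimplyConnectedSpace A]
    [LocallyPathConnectedSpace A] {f : A → ℂ} (hf : Continuous f) (h0 : ∀ a, f a ≠ 0) :
    ∃ L : A → ℂ, Continuous L ∧ ∀ a, Complex.exp (L a) = f a := by
  obtain ⟨a₀⟩ : Nonempty A := inferInstance
  obtain ⟨L, ⟨-, hL⟩, -⟩ := Complex.isCoveringMapOn_exp.existsUnique_continuousMap_lifts
    ⟨f, hf⟩ (a₀ := a₀) (Complex.exp_log (h0 a₀)) h0
  exact ⟨L, L.continuous, congrFun hL⟩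

/-- Every nowhere vanishing curve has a well-defined increment of its logarithm on `[0, 1]`,
which does not change when the curve is multiplied by a constant. -/
theorem exists_log_increment {f : ℝ → ℂ} (hf : Continuous f) (h0 : ∀ t, f t ≠ 0) :
    ∃ θ : ℂ, Complex.exp θ = f 1 / f 0 ∧ ∀ (c : ℂ) (l : ℝ → ℂ), Continuous l →
      (∀ t, Complex.exp (l t) = c * f t) → l 1 - l 0 = θ := by
  obtain ⟨L, hLc, hL⟩ := exists_continuous_log hf h0
  refine ⟨L 1 - L 0, by rw [Complex.exp_sub, hL, hL], fun c l hl h => ?_⟩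
  have key := Complex.isCoveringMap_exp.const_of_comp (hl.sub hLc) (fun a a' => by
    simp [Complex.exp_sub, hL, h, mul_div_cancel_right₀ _ (h0 _)]) 1 0
  simp only [Pi.sub_apply] at key
  linear_combination key

/-- The complete bipartite graph `K₃,₃` cannot be drawn in the plane in such a way that
non-adjacent edges are disjoint. -/
theorem k33_not_planar (A B : Fin 3 → ℂ) (γ : Fin 3 → Fin 3 → ℝ → ℂ)
    (hγ : ∀ i j, Continuous (γ i j)) (h0 : ∀ i j, γ i j 0 = A i) (h1 : ∀ i j, γ i j 1 = B j)
    (hdisj : ∀ i i' j j', i ≠ i' → j ≠ j' → ∀ s t, γ i j s ≠ γ i' j' t) : False := by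
  have other : ∀ j : Fin 3, ∃ j', j ≠ j' := by decide
  have hA : ∀ i i' j, i ≠ i' → ∀ t, γ i' j t - A i ≠ 0 := by
    intro i i' j hi t
    obtain ⟨j', hj⟩ := other j
    rw [sub_ne_zero, ← h0 i j']
    exact hdisj _ _ _ _ hi.symm hj _ _
  have hB : ∀ j i j', j ≠ j' → ∀ t, γ i j' t - B j ≠ 0 := by
    intro j i j' hj t
    obtain ⟨i', hi⟩ := other i
    rw [sub_ne_zero, ← h1 i' j]
    exact hdisj _ _ _ _ hi hj.symm _ _
  choose θ hθ hθ' using fun i i' j (h : i ≠ i') =>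
    exists_log_increment (f := fun t => γ i' j t - A i) (by have := hγ i' j; fun_prop) (hA i i' j h)
  choose φ _ hφ' using fun j i j' (h : j ≠ j') =>
    exists_log_increment (f := fun t => γ i j' t - B j) (by have := hγ i j'; fun_prop) (hB j i j' h)
  have square : ∀ i i' j j' (hi : i ≠ i') (hj : j ≠ j'),
      θ i i' j' hi + φ j' i j hj.symm = θ i' i j hi.symm + φ j i' j' hj := by
    intro i i' j j' hi hj
    have c1 := hγ i j
    have c2 := hγ i' j'
    obtain ⟨L, hLc, hL⟩ := exists_continuous_log (A := ℝ × ℝ)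
      (f := fun p => γ i j p.1 - γ i' j' p.2) (by fun_prop)
      (fun p => sub_ne_zero.2 (hdisj _ _ _ _ hi hj _ _))
    rw [← hθ' i i' j' hi (-1) (fun t => L (0, t)) (by fun_prop) (fun t => by simp [hL, h0]),
      ← hθ' i' i j hi.symm 1 (fun t => L (t, 0)) (by fun_prop) (fun t => by simp [hL, h0]),
      ← hφ' j i' j' hj (-1) (fun t => L (1, t)) (by fun_prop) (fun t => by simp [hL, h1]),
      ← hφ' j' i j hj.symm 1 (fun t => L (t, 1)) (by fun_prop) (fun t => by simp [hL, h1])]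
    ring
  have e01 : (0 : Fin 3) ≠ 1 := by decide
  have e12 : (1 : Fin 3) ≠ 2 := by decide
  have e20 : (2 : Fin 3) ≠ 0 := by decide
  let S : Fin 3 → ℂ := fun j => (θ 0 1 j e01 - θ 1 0 j e01.symm) +
    (θ 1 2 j e12 - θ 2 1 j e12.symm) + (θ 2 0 j e20 - θ 0 2 j e20.symm)
  have hS : S 0 + S 1 + S 2 = 0 := by
    have row : ∀ j j' (hj : j ≠ j'), _ := fun j j' hj =>
      (congrArg₂ (· + ·) (congrArg₂ (· + ·) (square 0 1 j j' e01 hj) (square 1 2 j j' e12 hj))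
        (square 2 0 j j' e20 hj))
    have r01 := row 0 1 e01
    have r10 := row 1 0 e01.symm
    have r12 := row 1 2 e12
    have r21 := row 2 1 e12.symm
    have r20 := row 2 0 e20
    have r02 := row 0 2 e20.symm
    simp only [S]
    linear_combination (r01 + r10 + r12 + r21 + r20 + r02) / 2
  have hexp : ∀ j, Complex.exp (S j) = -1 := by
    intro j
    have hne : ∀ i, B j - A i ≠ 0 := by
      intro i
      obtain ⟨i', hi⟩ := other i
      simpa [h1] using hA i i' j hi 1
    have hAA : ∀ i i', i ≠ i' → A i' - A i ≠ 0 := fun i i' hi => by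
      simpa [h0] using hA i i' j hi 0
    have n0 := hne 0
    have n1 := hne 1
    have n2 := hne 2
    have step : ∀ i i' (hi : i ≠ i'), Complex.exp (θ i i' j hi - θ i' i j hi.symm) =
        -((B j - A i) / (B j - A i')) := by
      intro i i' hi
      have := hne i'
      have := hAA _ _ hi
      have := hAA _ _ hi.symm
      rw [Complex.exp_sub, hθ, hθ, h0, h0, h1, h1]
      field_simp
      ring
    simp only [S]
    rw [Complex.exp_add, Complex.exp_add, step, step, step]
    field_simp
  have := congrArg Complex.exp hS
  rw [Complex.exp_add, Complex.exp_add, hexp, hexp, hexp, Complex.exp_zero] at this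
  norm_num at this

/-- `k33_not_planar` for edges given as connections inside plane sets. -/
theorem k33_not_joinedIn (A B : Fin 3 → ℝ × ℝ) (K : Fin 3 → Fin 3 → Set (ℝ × ℝ))
    (hK : ∀ i j, JoinedIn (K i j) (A i) (B j))
    (hd : ∀ i i' j j', i ≠ i' → j ≠ j' → Disjoint (K i j) (K i' j')) : False := by
  choose γ hγ using hK
  let e := Complex.equivRealProdCLM.symm
  refine k33_not_planar (fun i => e (A i)) (fun j => e (B j))
    (fun i j t => e ((γ i j).extend t)) (fun i j => by have := (γ i j).continuous_extend; fun_prop)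
    (by simp) (by simp) ?_
  intro i i' j j' hi hj s t h
  exact Set.disjoint_left.1 (hd i i' j j' hi hj) (hγ i j (projIcc 0 1 zero_le_one s))
    (e.injective h ▸ hγ i' j' (projIcc 0 1 zero_le_one t))

/-- A point of the closure of an open connected set can be joined to any point of that set
inside the union of the set with a ball around the point. -/
theorem IsOpen.joinedIn_union_ball {F : Set (ℝ × ℝ)} (hF : IsOpen F) (hc : IsConnected F)
    {z p : ℝ × ℝ} (hz : z ∈ F) (hp : p ∈ closure F) {r : ℝ} (hr : 0 < r) :
    JoinedIn (F ∪ Metric.ball p r) z p := by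
  obtain ⟨q, hq, hqp⟩ := Metric.mem_closure_iff.1 hp r hr
  have h1 : JoinedIn F z q := (hF.isConnected_iff_isPathConnected.1 hc).joinedIn z hz q hq
  have h2 : JoinedIn (Metric.ball p r) q p :=
    ((convex_ball p r).isPathConnected ⟨p, Metric.mem_ball_self hr⟩).joinedIn q
      (by rwa [Metric.mem_ball']) p (Metric.mem_ball_self hr)
  exact (h1.mono subset_union_left).trans (h2.mono subset_union_right)

namespace PlaneEmbedding

variable {G : SimpleGraph V} (E : PlaneEmbedding G)

/-- The part of the drawing that shows the subgraph induced on `P`. -/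
def drawingOn (P : Set V) : Set (ℝ × ℝ) :=
  E.vertexMap '' P ∪ ⋃ (a ∈ P) (b ∈ P) (h : G.Adj a b), Set.range (E.edgeMap h)

theorem mem_drawingOn {P : Set V} {x : ℝ × ℝ} :
    x ∈ E.drawingOn P ↔ (∃ a ∈ P, E.vertexMap a = x) ∨
      ∃ a ∈ P, ∃ b ∈ P, ∃ h : G.Adj a b, x ∈ Set.range (E.edgeMap h) := by
  simp only [drawingOn, mem_union, mem_image, mem_iUnion, exists_prop]

theorem drawingOn_univ : E.drawingOn univ = E.drawing := by
  simp [drawingOn, drawing]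

theorem drawingOn_mono {P Q : Set V} (h : P ⊆ Q) : E.drawingOn P ⊆ E.drawingOn Q := by
  intro x hx
  rw [mem_drawingOn] at hx ⊢
  obtain ⟨a, ha, hx⟩ | ⟨a, ha, b, hb, hab, hx⟩ := hx
  · exact .inl ⟨a, h ha, hx⟩
  · exact .inr ⟨a, h ha, b, h hb, hab, hx⟩

theorem drawingOn_subset_drawing (P : Set V) : E.drawingOn P ⊆ E.drawing :=
  E.drawingOn_univ ▸ E.drawingOn_mono (subset_univ P)

theorem vertexMap_mem_drawingOn {P : Set V} {a : V} :
    E.vertexMap a ∈ E.drawingOn P ↔ a ∈ P := by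
  refine ⟨fun h => ?_, fun h => E.mem_drawingOn.2 (.inl ⟨a, h, rfl⟩)⟩
  obtain ⟨b, hb, h⟩ | ⟨b, hb, c, hc, hbc, h⟩ := E.mem_drawingOn.1 h
  · exact E.vertex_inj h ▸ hb
  · obtain rfl | rfl := E.edge_no_vertex hbc a h <;> assumption

theorem isClosed_drawingOn [Finite V] (P : Set V) : IsClosed (E.drawingOn P) := by
  refine (P.toFinite.image _).isClosed.union ?_
  refine P.toFinite.isClosed_biUnion fun a _ => P.toFinite.isClosed_biUnion fun b _ =>
    isClosed_iUnion_of_finite fun h => ?_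
  exact (isCompact_range (E.edgeMap h).continuous).isClosed

theorem disjoint_drawingOn {P Q : Set V} (h : Disjoint P Q) :
    Disjoint (E.drawingOn P) (E.drawingOn Q) := by
  rw [Set.disjoint_left] at h ⊢
  intro x hP hQ
  obtain ⟨a, ha, rfl⟩ | ⟨a, ha, b, hb, hab, hx⟩ := E.mem_drawingOn.1 hP
  · exact h ha (E.vertexMap_mem_drawingOn.1 hQ)
  obtain ⟨c, hc, rfl⟩ | ⟨c, hc, d, hd, hcd, hx'⟩ := E.mem_drawingOn.1 hQ
  · exact h (E.vertexMap_mem_drawingOn.1 hP) hc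
  have hne : s(a, b) ≠ s(c, d) := by
    rw [Ne, Sym2.eq_iff]
    rintro (⟨rfl, -⟩ | ⟨rfl, -⟩)
    exacts [h ha hc, h ha hd]
  obtain ⟨y, ⟨rfl | rfl, hy | hy⟩, -⟩ := E.edge_int hab hcd hne ⟨hx, hx'⟩ <;> subst hy <;>
    exact h ‹_› ‹_›

theorem joinedIn_of_adj {P : Set V} {a b : V} (ha : a ∈ P) (hb : b ∈ P) (h : G.Adj a b) :
    JoinedIn (E.drawingOn P) (E.vertexMap a) (E.vertexMap b) :=
  ⟨⟨E.edgeMap h, E.edge_start h, E.edge_end h⟩,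
    fun t => E.mem_drawingOn.2 (.inr ⟨a, ha, b, hb, h, t, rfl⟩)⟩

/-- If `C` is closed under adjacency in `G - S` and `G - (S \ {s})` is connected, then every vertex
of `C` is joined to `s` inside the drawing of `C ∪ {s}`. -/
theorem joinedIn_of_connected {S C : Set V} {s x : V} (hCS : Disjoint C S)
    (hC : ∀ a ∈ C, ∀ b ∉ S, G.Adj a b → b ∈ C) (hs : s ∈ S)
    (hconn : (G.induce (S \ {s})ᶜ).Connected) (hx : x ∈ C) :
    JoinedIn (E.drawingOn (insert s C)) (E.vertexMap x) (E.vertexMap s) := by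
  have hxS : x ∉ S := Set.disjoint_left.1 hCS hx
  have key : ∀ a : ↥(S \ {s})ᶜ,
      Relation.ReflTransGen (G.induce (S \ {s})ᶜ).Adj ⟨x, fun h => hxS h.1⟩ a →
      JoinedIn (E.drawingOn (insert s C)) (E.vertexMap x) (E.vertexMap s) ∨
      ((a : V) ∈ C ∧ JoinedIn (E.drawingOn (insert s C)) (E.vertexMap x) (E.vertexMap a)) := by
    intro a ha
    induction ha with
    | refl =>
      exact .inr ⟨hx, JoinedIn.refl (E.vertexMap_mem_drawingOn.2 (mem_insert_of_mem s hx))⟩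
    | @tail b c _ hbc ih =>
      obtain ih | ⟨hb, ih⟩ := ih
      · exact .inl ih
      have hadj : G.Adj b c := hbc
      have hb' : (b : V) ∈ insert s C := mem_insert_of_mem s hb
      by_cases hcs : (c : V) = s
      · exact .inl (ih.trans (E.joinedIn_of_adj hb' (mem_insert s C) (by rwa [hcs] at hadj)))
      · have hc : (c : V) ∈ C := hC b hb c (fun h => c.2 ⟨h, hcs⟩) hadj
        exact .inr ⟨hc, ih.trans (E.joinedIn_of_adj hb' (mem_insert_of_mem s hc) hadj)⟩
  obtain h | ⟨h, -⟩ := key ⟨s, fun h => h.2 rfl⟩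
    ((SimpleGraph.reachable_iff_reflTransGen _ _).1 (hconn.preconnected _ _))
  · exact h
  · exact absurd hs (Set.disjoint_left.1 hCS h)

end PlaneEmbedding

/-- The three vertices of a 3-cut of a 3-connected planar graph never all lie on the
boundary of a common face (of any planar embedding). -/
theorem stmt2 [Fintype V] (G : SimpleGraph V) (h3 : IsKConnected 3 G)
    (u v w : V) (hcut : IsThreeCut G {u, v, w}) (E : PlaneEmbedding G) :
    ¬ ∃ F : Set (ℝ × ℝ), E.IsFace F ∧ E.vertexMap u ∈ frontier F ∧
      E.vertexMap v ∈ frontier F ∧ E.vertexMap w ∈ frontier F := by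
  rintro ⟨F, ⟨z, hz, rfl⟩, hu, hv, hw⟩
  obtain ⟨hcard, hnot⟩ := hcut
  set S : Set V := {u, v, w} with hS
  set F := connectedComponentIn E.drawingᶜ z
  simp only [SimpleGraph.Preconnected, not_forall] at hnot
  obtain ⟨x, y, hxy⟩ := hnot
  let C : ↥Sᶜ → Set V := fun x => {a | ∃ h : a ∈ Sᶜ, (G.induce Sᶜ).Reachable x ⟨a, h⟩}
  have hCS : ∀ x, Disjoint (C x) S := fun x => Set.disjoint_left.2 fun a ha => ha.1
  have hCx : ∀ x, (x : V) ∈ C x := fun x => ⟨x.2, .refl _⟩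
  have hC : ∀ x, ∀ a ∈ C x, ∀ b ∉ S, G.Adj a b → b ∈ C x := by
    rintro x a ⟨ha, hxa⟩ b hb hab
    have hab' : (G.induce Sᶜ).Adj ⟨a, ha⟩ ⟨b, hb⟩ := hab
    exact ⟨hb, hxa.trans hab'.reachable⟩
  have hCC : Disjoint (C x) (C y) :=
    Set.disjoint_left.2 fun a ⟨_, hxa⟩ ⟨_, hya⟩ => hxy (hxa.trans hya.symm)
  let s : Fin 3 → V := ![u, v, w]
  have hsS : ∀ j, s j ∈ S := by intro j; fin_cases j <;> simp [s, hS]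
  have hs : Function.Injective s := by
    have hrange : Set.range s = S := by
      ext a
      simp only [s, hS, Matrix.range_cons, Matrix.range_empty, mem_union, mem_insert_iff,
        mem_singleton_iff, mem_empty_iff_false, or_false]
    rw [← Set.injOn_univ, ← Set.ncard_image_iff, Set.image_univ, hrange, hcard]
    simp
  have hleg : ∀ x j, JoinedIn (E.drawingOn (insert (s j) (C x))) (E.vertexMap x)
      (E.vertexMap (s j)) := fun x j =>
    E.joinedIn_of_connected (hCS x) (hC x) (hsS j) (h3.2 _ (toFinite _) (by
      rw [Set.ncard_sdiff_singleton_of_mem (hsS j), hcard]; norm_num)) (hCx x)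
  have hclosed : IsClosed E.drawing := E.drawingOn_univ ▸ E.isClosed_drawingOn univ
  have hFo : IsOpen F := hclosed.isOpen_compl.connectedComponentIn
  have hFc : IsConnected F := isConnected_connectedComponentIn_iff.2 hz
  have hFd : ∀ P, Disjoint (E.drawingOn P) F := fun P =>
    (disjoint_compl_right.mono_left (E.drawingOn_subset_drawing P)).mono_right
      (connectedComponentIn_subset _ _)
  have hsF : ∀ j, E.vertexMap (s j) ∈ closure F := by
    intro j
    fin_cases j
    exacts [frontier_subset_closure hu, frontier_subset_closure hv, frontier_subset_closure hw]
  have hball : ∀ j, ∃ r > 0, Metric.ball (E.vertexMap (s j)) r ⊆ (E.drawingOn {s j}ᶜ)ᶜ :=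
    fun j => Metric.isOpen_iff.1 (E.isClosed_drawingOn _).isOpen_compl _
      (by simp [E.vertexMap_mem_drawingOn])
  choose r hr hrd using hball
  have hfar : ∀ x j j', j ≠ j' → Disjoint (E.drawingOn (insert (s j) (C x)))
      (F ∪ Metric.ball (E.vertexMap (s j')) (r j')) := by
    intro x j j' hj
    refine disjoint_union_right.2 ⟨hFd _, Set.disjoint_left.2 fun p hp hp' => hrd j' hp'
      (E.drawingOn_mono ?_ hp)⟩
    rintro a (rfl | ha) haj
    · exact hj (hs haj)
    · exact Set.disjoint_left.1 (hCS x) ha (haj ▸ hsS j')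
  have hcc : ∀ j j', j ≠ j' → Disjoint (E.drawingOn (insert (s j) (C x)))
      (E.drawingOn (insert (s j') (C y))) := by
    intro j j' hj
    refine E.disjoint_drawingOn ?_
    rw [Set.disjoint_insert_left, Set.disjoint_insert_right]
    refine ⟨?_, fun h => Set.disjoint_left.1 (hCS x) h (hsS j'), hCC⟩
    rintro (h | h)
    · exact hj (hs h)
    · exact Set.disjoint_left.1 (hCS y) h (hsS j)
  refine k33_not_joinedIn ![E.vertexMap x, E.vertexMap y, z] (fun j => E.vertexMap (s j))
    (fun i j => ![E.drawingOn (insert (s j) (C x)), E.drawingOn (insert (s j) (C y)),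
      F ∪ Metric.ball (E.vertexMap (s j)) (r j)] i) ?_ ?_
  · intro i j
    fin_cases i
    exacts [hleg x j, hleg y j,
      hFo.joinedIn_union_ball hFc (mem_connectedComponentIn hz) (hsF j) (hr j)]
  · intro i i' j j' hi hj
    fin_cases i <;> fin_cases i' <;> first | exact absurd rfl hi | skip
    exacts [hcc j j' hj, hfar x j j' hj, (hcc j' j hj.symm).symm, hfar y j j' hj,
      (hfar x j' j hj.symm).symm, (hfar y j' j hj.symm).symm]
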